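/- arXiv:0903.3862 — 2 statements merged into one kernel-verified Lean document; each statement's English description precedes it below -/
import Mathlib

section
/- Let N be a positive integer, for each positive divisor t of N let Θ_t be a set of φ(gcd(t,N/t)) pairs (u,v) of integers with gcd(u,t)=1, uv ≡ 1 mod t, whose first entries u are pairwise incongruent modulo gcd(t,N/t), and for each λ ∈ 𝔖_N fix a matrix M_λ ∈ Γ₀(N) congruent to diag(λ⁻¹, λ) mod N. Then the set of matrices {M_λ·B : λ ∈ 𝔖_N, B ∈ ∪_{t|N} 𝔐_{Θ_t}} is a complete set of representatives for the right cosets of {±E₂}Γ₁(N) in SL₂(ℤ). -/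
open scoped MatrixGroups
open Complex

/-- The Weierstrass ℘-function of the lattice `L_τ = ℤ + ℤτ`. -/
noncomputable def wp (τ z : ℂ) : ℂ :=
  1 / z ^ 2 + ∑' p : {p : ℤ × ℤ // p ≠ 0},
    (1 / (z - ((p.1.1 : ℂ) + (p.1.2 : ℂ) * τ)) ^ 2 - 1 / ((p.1.1 : ℂ) + (p.1.2 : ℂ) * τ) ^ 2)

/-- The function `W_𝔞` for the triple `𝔞 = [a₁,a₂,a₃]`. -/
noncomputable def Wfun (N : ℕ) (a₁ a₂ a₃ : ℤ) (τ : ℂ) : ℂ :=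
  (wp τ ((a₁ : ℂ) / N) - wp τ ((a₃ : ℂ) / N)) / (wp τ ((a₂ : ℂ) / N) - wp τ ((a₃ : ℂ) / N))

/-- Möbius action of an integral 2×2 matrix on ℂ. -/
noncomputable def moebius (A : Matrix (Fin 2) (Fin 2) ℤ) (τ : ℂ) : ℂ :=
  ((A 0 0 : ℂ) * τ + (A 0 1 : ℂ)) / ((A 1 0 : ℂ) * τ + (A 1 1 : ℂ))

/-- `𝔖_N = (ℤ/Nℤ)ˣ/{±1}`. -/
abbrev SNgroup (N : ℕ) := (ZMod N)ˣ ⧸ (Subgroup.closure ({-1} : Set (ZMod N)ˣ))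

/-- The triple `𝔞 = [a₁,a₂,a₃]` is in `𝔈`. -/
def memE (N : ℕ) (a : ℤ × ℤ × ℤ) : Prop :=
  0 < a.1 ∧ 0 < a.2.1 ∧ 0 < a.2.2 ∧ 2 * a.1 ≤ (N : ℤ) ∧ 2 * a.2.1 ≤ (N : ℤ) ∧
    2 * a.2.2 ≤ (N : ℤ) ∧ a.1 ≠ a.2.1 ∧ a.1 ≠ a.2.2 ∧ a.2.1 ≠ a.2.2

def memE1 (N : ℕ) (a : ℤ × ℤ × ℤ) : Prop :=
  memE N a ∧ IsCoprime (a.1 * a.2.1 * a.2.2) (N : ℤ)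

def memE2 (N : ℕ) (a : ℤ × ℤ × ℤ) : Prop :=
  memE1 N a ∧ IsCoprime (a.1 - a.2.2) (N : ℤ) ∧ IsCoprime (a.1 + a.2.2) (N : ℤ) ∧
    IsCoprime (a.2.1 - a.2.2) (N : ℤ) ∧ IsCoprime (a.2.1 + a.2.2) (N : ℤ)

/-- `M` is a lift to `Γ₀(N)` of `diag(λ⁻¹, λ)` for the class `s = λ ∈ 𝔖_N`. -/
def IsDiagLift (N : ℕ) (M : SL(2, ℤ)) (s : SNgroup N) : Prop :=
  ∃ u : (ZMod N)ˣ, (QuotientGroup.mk u : SNgroup N) = s ∧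
    ((M 0 0 : ℤ) : ZMod N) = ((u⁻¹ : (ZMod N)ˣ) : ZMod N) ∧
    ((M 0 1 : ℤ) : ZMod N) = 0 ∧ ((M 1 0 : ℤ) : ZMod N) = 0 ∧
    ((M 1 1 : ℤ) : ZMod N) = (u : ZMod N)

/-- The function `T_{𝔄,F}`. -/
noncomputable def Tfun (N : ℕ) {n : ℕ} (A : Fin n → ℤ × ℤ × ℤ)
    (F : MvPolynomial (Fin n) ℤ) (M : SNgroup N → SL(2, ℤ)) (τ : ℂ) : ℂ :=
  ∑ᶠ s : SNgroup N, MvPolynomial.aeval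
    (fun i => Wfun N (A i).1 (A i).2.1 (A i).2.2 (moebius ((M s : SL(2, ℤ)) : Matrix (Fin 2) (Fin 2) ℤ) τ)) F

/-- The matrix `B(t,u,v,k)`. -/
def Bmat (t : ℕ) (u v k : ℤ) : Matrix (Fin 2) (Fin 2) ℤ :=
  !![u, (u * v - 1) / (t : ℤ) + u * k; (t : ℤ), v + (t : ℤ) * k]

/-- `{a}` : the representative of `±a mod N` in `(0, N/2]` (paper's `{·}`). -/
def red (N : ℕ) (a : ℤ) : ℤ :=
  if 2 * (a % (N : ℤ)) ≤ (N : ℤ) then a % (N : ℤ) else (N : ℤ) - a % (N : ℤ)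

/-- `μ(a) ∈ {±1}` with `a ≡ μ(a){a} mod N`. -/
def muSign (N : ℕ) (a : ℤ) : ℤ :=
  if 2 * (a % (N : ℤ)) ≤ (N : ℤ) then 1 else -1

/-- `φ_s(τ) = (2πi)⁻²℘(s/N; L_τ) − 1/12`. -/
noncomputable def phiFun (N : ℕ) (s : ℤ) (τ : ℂ) : ℂ :=
  (1 / (2 * (Real.pi : ℂ) * Complex.I) ^ 2) * wp τ ((s : ℂ) / N) - 1 / 12

/-- `f[A]₂` : weight-2 slash of `φ_s`. -/
noncomputable def phiSlash (N : ℕ) (s : ℤ) (A : Matrix (Fin 2) (Fin 2) ℤ) (τ : ℂ) : ℂ :=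
  phiFun N s (moebius A τ) * ((A 1 0 : ℂ) * τ + (A 1 1 : ℂ)) ^ (-2 : ℤ)

/-- `q = e^{2πiτ/N}`. -/
noncomputable def qq (N : ℕ) (τ : ℂ) : ℂ :=
  Complex.exp (2 * (Real.pi : ℂ) * Complex.I * τ / N)

/-- `ζ = e^{2πi/N}`. -/
noncomputable def zetaN (N : ℕ) : ℂ :=
  Complex.exp (2 * (Real.pi : ℂ) * Complex.I / N)

/-- `θ_{a,b} = ζ^a(1−ζ^{b−a})(1−ζ^{b+a})/((1−ζ^a)²(1−ζ^b)²)`. -/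
noncomputable def theta (ζ : ℂ) (a b : ℤ) : ℂ :=
  ζ ^ a * (1 - ζ ^ (b - a)) * (1 - ζ ^ (b + a)) / ((1 - ζ ^ a) ^ 2 * (1 - ζ ^ b) ^ 2)

lemma coprime_right_of_mul_modEq_one {u v n : ℤ} (h : u * v ≡ 1 [ZMOD n]) : IsCoprime v n := by
  obtain ⟨x, hx⟩ := h.dvd
  exact ⟨u, x, by linear_combination -hx⟩

lemma nat_div_gcd_sq_mul (t m : ℕ) (ht : 0 < t) :
    t * m / Nat.gcd (t ^ 2) (t * m) = m / Nat.gcd t m := by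
  rw [sq, Nat.gcd_mul_left, Nat.mul_div_mul_left _ _ ht]

/-- Every row `(t, d)` is moved by a unit fixing `t` to a row `(t, v + t * k)` with `k` reduced. -/
lemma exists_scaling_to_reduced_row (t m : ℕ) (hm : 0 < m) (d v : ℤ)
    (hd : IsCoprime d (t : ℤ)) (hv : IsCoprime v (t : ℤ))
    (hdv : v ≡ d [ZMOD (Nat.gcd t m : ℤ)]) :
    ∃ μ k : ℤ, IsCoprime μ ((t * m : ℕ) : ℤ) ∧ μ * t ≡ t [ZMOD ((t * m : ℕ) : ℤ)] ∧
      μ * d ≡ v + t * k [ZMOD ((t * m : ℕ) : ℤ)] ∧ 0 ≤ k ∧ k < ((m / Nat.gcd t m : ℕ) : ℤ) := by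
  obtain ⟨m', hm'⟩ := Nat.gcd_dvd_right t m
  obtain ⟨t', ht'⟩ := Nat.gcd_dvd_left t m
  have hg : 0 < Nat.gcd t m := Nat.gcd_pos_of_pos_right _ hm
  have hdiv : m / Nat.gcd t m = m' := Nat.div_eq_of_eq_mul_right hg hm'
  have hm'0 : 0 < m' := Nat.pos_of_ne_zero (by rintro rfl; simp at hm'; omega)
  have hbez : (Nat.gcd t m : ℤ) = t * Nat.gcdA t m + m * Nat.gcdB t m := Nat.gcd_eq_gcd_ab t m
  rw [hdiv]
  generalize Nat.gcd t m = g at *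
  generalize Nat.gcdA t m = α at *
  generalize Nat.gcdB t m = β at *
  obtain ⟨r, hr⟩ := hdv.symm.dvd
  obtain ⟨e, f, hef⟩ := hd
  have hmg : (m : ℤ) = g * m' := by exact_mod_cast hm'
  have htg : (t : ℤ) = g * t' := by exact_mod_cast ht'
  let y : ℤ := -(α * r + m * β * r * f)
  let q : ℤ := y / m'
  let k : ℤ := y % m'
  have hyk : y = k + m' * q := (Int.emod_add_mul_ediv y m').symm
  let x : ℤ := β * r * e - e * q * t'
  have key : (1 + m * x) * d = v + t * k + (t * m) * (f * q * t') := by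
    have h1 : v - d = g * r := by linarith
    have h2 : t * k = t * y - t * (m' * q) := by rw [hyk]; ring
    have h3 : (t : ℤ) * m' = m * t' := by rw [hmg, htg]; ring
    rw [h2]
    simp only [x, y]
    linear_combination -h1 - r * hbez + m * (β * r - q * t') * hef + q * h3
  refine ⟨1 + m * x, k, ?_, ?_, ?_, Int.emod_nonneg _ (by omega), Int.emod_lt_of_pos _ (by omega)⟩
  · push_cast
    refine IsCoprime.mul_right ?_ ⟨1, -x, by ring⟩
    have : IsCoprime ((1 + m * x) * d) (t : ℤ) := by
      rw [key, show v + t * k + t * m * (f * q * t')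
        = v + t * (k + m * (f * q * t')) by ring]
      exact hv.add_mul_left_left _
    exact this.of_mul_left_left
  · refine (Int.modEq_iff_dvd.2 ⟨-x, ?_⟩)
    push_cast; ring
  · refine (Int.modEq_iff_dvd.2 ⟨-(f * q * t'), ?_⟩)
    rw [key]; push_cast; ring

/-- A unit relating two reduced rows with the same `t` and `v` is trivial. -/
lemma reduced_row_unique (t m : ℕ) (ht : 0 < t) (hm : 0 < m) (v μ k k' : ℤ)
    (hv : IsCoprime v (t : ℤ)) (h1 : μ * t ≡ t [ZMOD ((t * m : ℕ) : ℤ)])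
    (h2 : μ * (v + t * k) ≡ v + t * k' [ZMOD ((t * m : ℕ) : ℤ)])
    (hk : 0 ≤ k ∧ k < ((m / Nat.gcd t m : ℕ) : ℤ))
    (hk' : 0 ≤ k' ∧ k' < ((m / Nat.gcd t m : ℕ) : ℤ)) :
    k = k' ∧ μ ≡ 1 [ZMOD ((t * m : ℕ) : ℤ)] := by
  obtain ⟨m', hm'⟩ := Nat.gcd_dvd_right t m
  obtain ⟨t', ht'⟩ := Nat.gcd_dvd_left t m
  have hg : 0 < Nat.gcd t m := Nat.gcd_pos_of_pos_right _ hm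
  have hdiv : m / Nat.gcd t m = m' := Nat.div_eq_of_eq_mul_right hg hm'
  have hcop : IsCoprime (t' : ℤ) (m' : ℤ) := by
    have hbez : (Nat.gcd t m : ℤ) = t * Nat.gcdA t m + m * Nat.gcdB t m := Nat.gcd_eq_gcd_ab t m
    refine ⟨Nat.gcdA t m, Nat.gcdB t m, ?_⟩
    have hmg : (m : ℤ) = Nat.gcd t m * m' := by exact_mod_cast hm'
    have htg : (t : ℤ) = Nat.gcd t m * t' := by exact_mod_cast ht'
    have hg' : (Nat.gcd t m : ℤ) ≠ 0 := by exact_mod_cast hg.ne'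
    apply mul_left_cancel₀ hg'
    linear_combination -hbez - Nat.gcdA t m * htg - Nat.gcdB t m * hmg
  rw [hdiv] at hk hk'
  generalize Nat.gcd t m = g at *
  have hmg : (m : ℤ) = g * m' := by exact_mod_cast hm'
  have htg : (t : ℤ) = g * t' := by exact_mod_cast ht'
  have ht0 : (t : ℤ) ≠ 0 := by exact_mod_cast ht.ne'
  have hg0 : (g : ℤ) ≠ 0 := by exact_mod_cast hg.ne'
  obtain ⟨a, ha⟩ := h1.symm.dvd
  obtain ⟨b, hb⟩ := h2.symm.dvd
  push_cast at ha hb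
  have ha' : μ - 1 = m * a := mul_left_cancel₀ ht0 (by linear_combination ha)
  have hdt : (t : ℤ) ∣ μ - 1 := by
    refine hv.symm.dvd_of_dvd_mul_right ⟨m * b + k' - μ * k, ?_⟩
    linear_combination hb
  have hdvd : (g : ℤ) * (t' * m') ∣ μ - 1 := by
    have h3 : (g : ℤ) * m' ∣ μ - 1 := ⟨a, by rw [ha', hmg]⟩
    rw [htg] at hdt
    obtain ⟨z, hz⟩ : (g : ℤ) ∣ μ - 1 := (dvd_mul_right _ _).trans hdt
    rw [hz] at hdt h3 ⊢
    exact mul_dvd_mul_left _ (hcop.mul_dvd ((mul_dvd_mul_iff_left hg0).1 hdt)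
      ((mul_dvd_mul_iff_left hg0).1 h3))
  obtain ⟨z, hz⟩ := hdvd
  have hkk : k' - k = m' * (z * (v + t * k) - g * b) := by
    apply mul_left_cancel₀ ht0
    rw [hmg] at hb
    have hz' : μ - 1 = t * m' * z := by rw [hz, htg]; ring
    linear_combination -hb + (v + t * k) * hz'
  have hkeq : k = k' := by
    have hmod : k ≡ k' [ZMOD (m' : ℤ)] := Int.modEq_iff_dvd.2 ⟨_, hkk⟩
    have := hmod
    rw [Int.ModEq, Int.emod_eq_of_lt hk.1 hk.2, Int.emod_eq_of_lt hk'.1 hk'.2] at this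
    exact this
  refine ⟨hkeq, ?_⟩
  subst hkeq
  obtain ⟨e, f, hef⟩ := hv
  refine Int.ModEq.symm (Int.modEq_iff_dvd.2 ⟨e * b - e * k * a + f * a, ?_⟩)
  push_cast
  linear_combination (-(μ - 1)) * hef + e * hb + (f - e * k) * ha

lemma exists_mem_snd_modEq (t g : ℕ) (hg : 0 < g) (hgt : g ∣ t) (S : Finset (ℤ × ℤ))
    (hcard : S.card = Nat.totient g)
    (hmem : ∀ p ∈ S, p.1 * p.2 ≡ 1 [ZMOD (t : ℤ)])
    (hinc : ∀ p ∈ S, ∀ q ∈ S, p.1 ≡ q.1 [ZMOD (g : ℤ)] → p = q)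
    (d : ℤ) (hd : IsCoprime d (t : ℤ)) : ∃ p ∈ S, p.2 ≡ d [ZMOD (g : ℤ)] := by
  have : NeZero g := ⟨hg.ne'⟩
  have hone : ∀ p ∈ S, (p.1 : ZMod g) * (p.2 : ZMod g) = 1 := fun p hp => by
    have := (ZMod.intCast_eq_intCast_iff _ _ g).2
      ((hmem p hp).of_dvd (Int.natCast_dvd_natCast.2 hgt))
    exact_mod_cast this
  let f : S → (ZMod g)ˣ := fun p =>
    ⟨(p.1.1 : ZMod g), (p.1.2 : ZMod g), hone p.1 p.2, by rw [mul_comm]; exact hone p.1 p.2⟩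
  have hf : Function.Injective f := fun p q hpq => Subtype.ext <|
    hinc _ p.2 _ q.2 ((ZMod.intCast_eq_intCast_iff _ _ g).1 (congrArg Units.val hpq))
  have hbij : Function.Bijective f := (Fintype.bijective_iff_injective_and_card f).2
    ⟨hf, by rw [Fintype.card_coe, hcard, ZMod.card_units_eq_totient]⟩
  obtain ⟨e, e', he⟩ := hd
  have hgd : (d : ZMod g) * (e : ZMod g) = 1 := by
    have h0 : ((t : ℤ) : ZMod g) = 0 := by
      exact_mod_cast (ZMod.natCast_eq_zero_iff t g).2 hgt
    have := congrArg (Int.cast : ℤ → ZMod g) he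
    push_cast at this h0
    rw [h0] at this
    linear_combination this
  obtain ⟨p, hp⟩ := hbij.2 (⟨(d : ZMod g), (e : ZMod g), hgd, by rw [mul_comm]; exact hgd⟩)⁻¹
  refine ⟨p.1, p.2, (ZMod.intCast_eq_intCast_iff _ _ g).1 ?_⟩
  have := congrArg (fun x : (ZMod g)ˣ => ((x⁻¹ : (ZMod g)ˣ) : ZMod g)) hp
  simpa [f] using this

lemma Bmat_det (t : ℕ) (u v k : ℤ) (h : u * v ≡ 1 [ZMOD (t : ℤ)]) : (Bmat t u v k).det = 1 := by
  have : (t : ℤ) * ((u * v - 1) / (t : ℤ)) = u * v - 1 := Int.mul_ediv_cancel' h.symm.dvd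
  rw [Bmat, Matrix.det_fin_two_of]
  linear_combination -this

/-- Two matrices of `SL(2, ℤ)` lie in the same right coset of `Γ₁(N)` iff their bottom rows
agree modulo `N`. -/
lemma exists_Gamma1_mul_eq_iff (N : ℕ) (A C : SL(2, ℤ)) :
    (∃ γ : SL(2, ℤ), γ ∈ CongruenceSubgroup.Gamma1 N ∧
      (A : Matrix (Fin 2) (Fin 2) ℤ) = (γ : Matrix (Fin 2) (Fin 2) ℤ) * C) ↔
    (((A 1 0 : ℤ) : ZMod N) = (C 1 0 : ℤ) ∧ ((A 1 1 : ℤ) : ZMod N) = (C 1 1 : ℤ)) := by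
  constructor
  · rintro ⟨γ, hγ, h⟩
    obtain ⟨-, h11, h10⟩ := (CongruenceSubgroup.Gamma1_mem N γ).1 hγ
    rw [h]
    simp [Matrix.mul_apply, Fin.sum_univ_two, h11, h10]
  · rintro ⟨h0, h1⟩
    have hA := congrArg (Int.cast : ℤ → ZMod N) A.det_coe
    have hC := congrArg (Int.cast : ℤ → ZMod N) C.det_coe
    rw [Matrix.det_fin_two] at hA hC
    push_cast at hA hC
    refine ⟨A * C⁻¹, (CongruenceSubgroup.Gamma1_mem N _).2 ?_, ?_⟩
    · simp only [Matrix.SpecialLinearGroup.coe_mul, Matrix.SpecialLinearGroup.coe_inv,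
        Matrix.adjugate_fin_two, Matrix.mul_apply, Fin.sum_univ_two, Matrix.of_apply,
        Matrix.cons_val', Matrix.cons_val_zero, Matrix.cons_val_one, Matrix.cons_val_fin_one]
      push_cast
      rw [← h0, ← h1] at hC
      rw [← h0, ← h1]
      exact ⟨by linear_combination hA, by linear_combination hC, by ring⟩
    · rw [← Matrix.SpecialLinearGroup.coe_mul, inv_mul_cancel_right]

lemma SNgroup_mk_eq_iff (N : ℕ) (a b : (ZMod N)ˣ) :
    (QuotientGroup.mk a : SNgroup N) = QuotientGroup.mk b ↔ a = b ∨ a = -b := by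
  rw [QuotientGroup.eq, Subgroup.mem_closure_singleton]
  constructor
  · rintro ⟨n, hn⟩
    have hb : b = a * (-1) ^ n := by rw [hn]; group
    rcases Int.even_or_odd n with h | h
    · left; rw [hb, h.neg_one_zpow, mul_one]
    · right; rw [hb, h.neg_one_zpow]; simp
  · rintro (rfl | rfl)
    · exact ⟨0, by simp⟩
    · exact ⟨1, by simp [inv_neg]⟩

lemma bottom_row_mul_Bmat (N : ℕ) (M : SL(2, ℤ)) (w : ZMod N) (h0 : ((M 1 0 : ℤ) : ZMod N) = 0)
    (h1 : ((M 1 1 : ℤ) : ZMod N) = w) (t : ℕ) (u v k : ℤ) :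
    ((((M : Matrix (Fin 2) (Fin 2) ℤ) * Bmat t u v k) 1 0 : ℤ) : ZMod N) = w * t ∧
    ((((M : Matrix (Fin 2) (Fin 2) ℤ) * Bmat t u v k) 1 1 : ℤ) : ZMod N) = w * (v + t * k) := by
  subst h1
  simp [Matrix.mul_apply, Fin.sum_univ_two, Bmat, h0]

lemma dvd_of_natCast_eq_mul {N t₁ t₂ : ℕ} (h₂ : t₂ ∣ N) (w : ZMod N)
    (h : (t₁ : ZMod N) = w * t₂) : t₂ ∣ t₁ := by
  have := congrArg (ZMod.castHom h₂ (ZMod t₂)) h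
  rw [map_mul, map_natCast, map_natCast, ZMod.natCast_self, mul_zero] at this
  exact (ZMod.natCast_eq_zero_iff _ _).1 this

/-- The rows `(t, v + t * k)` are a complete set of representatives, up to units, of the
primitive rows modulo `N`: existence. -/
lemma exists_unit_mul_row (N : ℕ) (hN : 0 < N) (Θ : ℕ → Finset (ℤ × ℤ))
    (hcard : ∀ t ∈ N.divisors, (Θ t).card = Nat.totient (Nat.gcd t (N / t)))
    (hmem : ∀ t ∈ N.divisors, ∀ p ∈ Θ t, p.1 * p.2 ≡ 1 [ZMOD (t : ℤ)])
    (hinc : ∀ t ∈ N.divisors, ∀ p ∈ Θ t, ∀ q ∈ Θ t,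
        p.1 ≡ q.1 [ZMOD ((Nat.gcd t (N / t) : ℕ) : ℤ)] → p = q)
    (c d : ℤ) (hcd : IsCoprime c d) :
    ∃ t ∈ N.divisors, ∃ p ∈ Θ t, ∃ k : ℤ, 0 ≤ k ∧ k < ((N / Nat.gcd (t ^ 2) N : ℕ) : ℤ) ∧
      ∃ w : (ZMod N)ˣ, (c : ZMod N) = w * t ∧ (d : ZMod N) = w * (p.2 + t * k) := by
  have : NeZero N := ⟨hN.ne'⟩
  obtain ⟨t, htN, w₀, hw₀, hc⟩ := ZMod.eq_unit_mul_divisor (c : ZMod N)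
  obtain ⟨w₀, rfl⟩ := hw₀
  have htdiv : t ∈ N.divisors := Nat.mem_divisors.2 ⟨htN, hN.ne'⟩
  obtain ⟨m, rfl⟩ := htN
  have ht : 0 < t := Nat.pos_of_mul_pos_right hN
  have hm : 0 < m := Nat.pos_of_mul_pos_left hN
  obtain ⟨d₀, hd₀⟩ := ZMod.intCast_surjective (((w₀⁻¹ : (ZMod (t * m))ˣ) : ZMod (t * m)) * (d : ZMod (t * m)))
  have hdd : (d : ZMod (t * m)) = w₀ * d₀ := by rw [hd₀, Units.mul_inv_cancel_left]
  have hd₀t : IsCoprime d₀ (t : ℤ) := by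
    obtain ⟨a, b, hab⟩ := hcd
    have h := congrArg (ZMod.castHom (dvd_mul_right t m) (ZMod t))
      (congrArg (Int.cast : ℤ → ZMod (t * m)) hab)
    push_cast at h
    rw [hc, hdd] at h
    simp only [map_add, map_mul, map_intCast, map_natCast, map_one, ZMod.natCast_self] at h
    obtain ⟨z, hz⟩ := ZMod.intCast_surjective
      (ZMod.castHom (dvd_mul_right t m) (ZMod t) (w₀ : ZMod (t * m)))
    rw [← hz] at h
    refine coprime_right_of_mul_modEq_one (u := b * z) ((ZMod.intCast_eq_intCast_iff _ _ t).1 ?_)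
    push_cast
    linear_combination h
  have hdivt : t * m / t = m := Nat.mul_div_cancel_left m ht
  have hcard' := hcard t htdiv
  have hinc' := hinc t htdiv
  rw [hdivt] at hcard' hinc'
  obtain ⟨p, hp, hpd⟩ := exists_mem_snd_modEq t (Nat.gcd t m) (Nat.gcd_pos_of_pos_left _ ht)
    (Nat.gcd_dvd_left t m) (Θ t) hcard' (hmem t htdiv) hinc' d₀ hd₀t
  obtain ⟨μ, k, hμ, hμt, hμd, hk0, hk⟩ := exists_scaling_to_reduced_row t m hm d₀ p.2 hd₀t
    (coprime_right_of_mul_modEq_one (hmem t htdiv p hp)) hpd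
  have hμu : IsUnit (μ : ZMod (t * m)) := by
    obtain ⟨a, b, hab⟩ := hμ
    have h := congrArg (Int.cast : ℤ → ZMod (t * m)) hab
    rw [Int.cast_add, Int.cast_mul, Int.cast_mul, Int.cast_natCast, ZMod.natCast_self, mul_zero,
      add_zero, Int.cast_one] at h
    exact IsUnit.of_mul_eq_one_right _ h
  obtain ⟨μ', hμ'⟩ := hμu
  have e1 := (ZMod.intCast_eq_intCast_iff _ _ (t * m)).2 hμt
  have e2 := (ZMod.intCast_eq_intCast_iff _ _ (t * m)).2 hμd
  rw [Int.cast_mul, ← hμ', Int.cast_natCast] at e1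
  rw [Int.cast_mul, ← hμ', Int.cast_add, Int.cast_mul, Int.cast_natCast] at e2
  refine ⟨t, htdiv, p, hp, k, hk0, by rwa [nat_div_gcd_sq_mul t m ht], w₀ * μ'⁻¹, ?_, ?_⟩
  · rw [hc, Units.val_mul, mul_assoc]
    conv_rhs => rw [← e1]
    rw [Units.inv_mul_cancel_left]
  · rw [hdd, Units.val_mul, mul_assoc, ← e2, Units.inv_mul_cancel_left]

/-- The rows `(t, v + t * k)` are a complete set of representatives, up to units, of the
primitive rows modulo `N`: uniqueness. -/
lemma unit_mul_row_unique (N : ℕ) (hN : 0 < N) (Θ : ℕ → Finset (ℤ × ℤ))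
    (hmem : ∀ t ∈ N.divisors, ∀ p ∈ Θ t, p.1 * p.2 ≡ 1 [ZMOD (t : ℤ)])
    (hinc : ∀ t ∈ N.divisors, ∀ p ∈ Θ t, ∀ q ∈ Θ t,
        p.1 ≡ q.1 [ZMOD ((Nat.gcd t (N / t) : ℕ) : ℤ)] → p = q)
    {t₁ t₂ : ℕ} (ht₁ : t₁ ∈ N.divisors) (ht₂ : t₂ ∈ N.divisors) {p₁ p₂ : ℤ × ℤ}
    (hp₁ : p₁ ∈ Θ t₁) (hp₂ : p₂ ∈ Θ t₂) {k₁ k₂ : ℤ}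
    (hk₁ : 0 ≤ k₁ ∧ k₁ < ((N / Nat.gcd (t₁ ^ 2) N : ℕ) : ℤ))
    (hk₂ : 0 ≤ k₂ ∧ k₂ < ((N / Nat.gcd (t₂ ^ 2) N : ℕ) : ℤ)) (w : (ZMod N)ˣ)
    (h0 : (w : ZMod N) * t₁ = t₂) (h1 : (w : ZMod N) * (p₁.2 + t₁ * k₁) = p₂.2 + t₂ * k₂) :
    t₁ = t₂ ∧ p₁ = p₂ ∧ k₁ = k₂ ∧ w = 1 := by
  obtain rfl : t₁ = t₂ := Nat.dvd_antisymm
    (dvd_of_natCast_eq_mul (Nat.dvd_of_mem_divisors ht₁) w h0.symm)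
    (dvd_of_natCast_eq_mul (Nat.dvd_of_mem_divisors ht₂) (w⁻¹ : (ZMod N)ˣ)
      (by rw [← h0, Units.inv_mul_cancel_left]))
  obtain ⟨m, rfl⟩ := Nat.dvd_of_mem_divisors ht₁
  have ht : 0 < t₁ := Nat.pos_of_mul_pos_right hN
  have hm : 0 < m := Nat.pos_of_mul_pos_left hN
  obtain ⟨μ, hμ⟩ := ZMod.intCast_surjective (w : ZMod (t₁ * m))
  have e1 : μ * t₁ ≡ t₁ [ZMOD ((t₁ * m : ℕ) : ℤ)] := by
    refine (ZMod.intCast_eq_intCast_iff _ _ (t₁ * m)).1 ?_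
    rw [Int.cast_mul, hμ, Int.cast_natCast, h0]
  have e2 : μ * (p₁.2 + t₁ * k₁) ≡ p₂.2 + t₁ * k₂ [ZMOD ((t₁ * m : ℕ) : ℤ)] := by
    refine (ZMod.intCast_eq_intCast_iff _ _ (t₁ * m)).1 ?_
    simp only [Int.cast_mul, Int.cast_add, hμ, Int.cast_natCast]
    exact h1
  have hpeq : p₁ = p₂ := by
    refine hinc t₁ ht₁ p₁ hp₁ p₂ hp₂ ?_
    rw [Nat.mul_div_cancel_left m ht]
    have hgt : ((Nat.gcd t₁ m : ℕ) : ℤ) ∣ t₁ := Int.natCast_dvd_natCast.2 (Nat.gcd_dvd_left _ _)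
    have hgm : ((Nat.gcd t₁ m : ℕ) : ℤ) ∣ m := Int.natCast_dvd_natCast.2 (Nat.gcd_dvd_right _ _)
    have hμ1 : μ ≡ 1 [ZMOD (m : ℤ)] := by
      obtain ⟨a, ha⟩ := e1.dvd
      have ht0 : (t₁ : ℤ) ≠ 0 := by exact_mod_cast ht.ne'
      refine Int.modEq_iff_dvd.2 ⟨a, mul_left_cancel₀ ht0 ?_⟩
      push_cast at ha
      linear_combination ha
    have hμg := hμ1.of_dvd hgm
    have hvt : μ * p₁.2 ≡ p₂.2 [ZMOD (t₁ : ℤ)] := by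
      obtain ⟨b, hb⟩ := e2.dvd
      refine Int.modEq_iff_dvd.2 ⟨m * b - k₂ + μ * k₁, ?_⟩
      push_cast at hb
      linear_combination hb
    have hv : p₁.2 ≡ p₂.2 [ZMOD ((Nat.gcd t₁ m : ℕ) : ℤ)] := by
      have h := (hμg.mul_right p₁.2).symm.trans (hvt.of_dvd hgt)
      rwa [one_mul] at h
    have hone₁ := (hmem t₁ ht₁ p₁ hp₁).of_dvd hgt
    have hone₂ := (hmem t₁ ht₂ p₂ hp₂).of_dvd hgt
    calc p₁.1 = p₁.1 * 1 := (mul_one _).symm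
      _ ≡ p₁.1 * (p₂.1 * p₂.2) [ZMOD _] := (hone₂.mul_left _).symm
      _ = p₁.1 * p₂.1 * p₂.2 := by ring
      _ ≡ p₁.1 * p₂.1 * p₁.2 [ZMOD _] := (hv.mul_left _).symm
      _ = (p₁.1 * p₁.2) * p₂.1 := by ring
      _ ≡ 1 * p₂.1 [ZMOD _] := hone₁.mul_right _
      _ = p₂.1 := one_mul _
  subst hpeq
  rw [nat_div_gcd_sq_mul t₁ m ht] at hk₁ hk₂
  obtain ⟨hk, hμ1⟩ := reduced_row_unique t₁ m ht hm p₁.2 μ k₁ k₂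
    (coprime_right_of_mul_modEq_one (hmem t₁ ht₁ p₁ hp₁)) e1 e2 hk₁ hk₂
  refine ⟨rfl, rfl, hk, Units.ext ?_⟩
  have h := (ZMod.intCast_eq_intCast_iff _ _ (t₁ * m)).2 hμ1
  rw [← hμ, h, Int.cast_one, Units.val_one]

/-- Cosets of `{±1}Γ₁(N)` in `SL(2, ℤ)` are detected by bottom rows modulo `N` up to sign. -/
lemma exists_Gamma1_mul_eq_or_neg_iff (N : ℕ) (A : SL(2, ℤ)) (C : Matrix (Fin 2) (Fin 2) ℤ)
    (hC : C.det = 1) :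
    (∃ γ : SL(2, ℤ), γ ∈ CongruenceSubgroup.Gamma1 N ∧
        ((A : Matrix (Fin 2) (Fin 2) ℤ) = (γ : Matrix (Fin 2) (Fin 2) ℤ) * C ∨
         (A : Matrix (Fin 2) (Fin 2) ℤ) = -((γ : Matrix (Fin 2) (Fin 2) ℤ) * C))) ↔
    ∃ ε : (ZMod N)ˣ, (ε = 1 ∨ ε = -1) ∧ ((A 1 0 : ℤ) : ZMod N) = ε * (C 1 0 : ℤ) ∧
      ((A 1 1 : ℤ) : ZMod N) = ε * (C 1 1 : ℤ) := by
  obtain ⟨C, rfl⟩ : ∃ C' : SL(2, ℤ), (C' : Matrix (Fin 2) (Fin 2) ℤ) = C := ⟨⟨C, hC⟩, rfl⟩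
  have hpos := exists_Gamma1_mul_eq_iff N A C
  have hneg := exists_Gamma1_mul_eq_iff N (-A) C
  simp only [and_or_left, exists_or, or_and_right, exists_eq_left, ← neg_eq_iff_eq_neg]
  rw [hpos, ← Matrix.SpecialLinearGroup.coe_neg, hneg]
  simp [neg_eq_iff_eq_neg]

/-- `{M_λ·B : λ ∈ 𝔖_N, B ∈ ∪_{t|N} 𝔐_{Θ_t}}` is a complete set of representatives
of the right cosets of `{±E₂}Γ₁(N)` in `SL₂(ℤ)`. -/
theorem stmt2 (N : ℕ) (hN : 0 < N) (Θ : ℕ → Finset (ℤ × ℤ))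
    (hcard : ∀ t ∈ N.divisors, (Θ t).card = Nat.totient (Nat.gcd t (N / t)))
    (hmem : ∀ t ∈ N.divisors, ∀ p ∈ Θ t,
        IsCoprime p.1 (t : ℤ) ∧ p.1 * p.2 ≡ 1 [ZMOD (t : ℤ)])
    (hinc : ∀ t ∈ N.divisors, ∀ p ∈ Θ t, ∀ q ∈ Θ t,
        p.1 ≡ q.1 [ZMOD ((Nat.gcd t (N / t) : ℕ) : ℤ)] → p = q)
    (M : SNgroup N → SL(2, ℤ))
    (hM : ∀ s, M s ∈ CongruenceSubgroup.Gamma0 N ∧ IsDiagLift N (M s) s) :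
    ∀ A : SL(2, ℤ), ∃! C : Matrix (Fin 2) (Fin 2) ℤ,
      (∃ s : SNgroup N, ∃ t ∈ N.divisors, ∃ p ∈ Θ t, ∃ k : ℤ,
          0 ≤ k ∧ k < ((N / Nat.gcd (t ^ 2) N : ℕ) : ℤ) ∧
          C = ((M s : SL(2, ℤ)) : Matrix (Fin 2) (Fin 2) ℤ) * Bmat t p.1 p.2 k) ∧
      ∃ γ : SL(2, ℤ), γ ∈ CongruenceSubgroup.Gamma1 N ∧
        ((A : Matrix (Fin 2) (Fin 2) ℤ) = (γ : Matrix (Fin 2) (Fin 2) ℤ) * C ∨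
         (A : Matrix (Fin 2) (Fin 2) ℤ) = -((γ : Matrix (Fin 2) (Fin 2) ℤ) * C)) := by
  have hmem' : ∀ t ∈ N.divisors, ∀ p ∈ Θ t, p.1 * p.2 ≡ 1 [ZMOD (t : ℤ)] :=
    fun t ht p hp => (hmem t ht p hp).2
  have hdet : ∀ s : SNgroup N, ∀ t ∈ N.divisors, ∀ p ∈ Θ t, ∀ k : ℤ,
      (((M s : SL(2, ℤ)) : Matrix (Fin 2) (Fin 2) ℤ) * Bmat t p.1 p.2 k).det = 1 :=
    fun s t ht p hp k => by
      rw [Matrix.det_mul, (M s).det_coe, Bmat_det t _ _ k (hmem' t ht p hp), mul_one]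
  intro A
  refine existsUnique_of_exists_of_unique ?_ ?_
  · have hcop : IsCoprime (A 1 0) (A 1 1) := by
      have := A.det_coe
      rw [Matrix.det_fin_two] at this
      exact ⟨-A 0 1, A 0 0, by linear_combination this⟩
    obtain ⟨t, ht, p, hp, k, hk0, hk, w, hw0, hw1⟩ :=
      exists_unit_mul_row N hN Θ hcard hmem' hinc _ _ hcop
    obtain ⟨-, u, hu, -, -, h0, h1⟩ := hM (QuotientGroup.mk w)
    refine ⟨_, ⟨QuotientGroup.mk w, t, ht, p, hp, k, hk0, hk, rfl⟩, ?_⟩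
    rw [exists_Gamma1_mul_eq_or_neg_iff N A _ (hdet _ t ht p hp k)]
    obtain ⟨r0, r1⟩ := bottom_row_mul_Bmat N _ _ h0 h1 t p.1 p.2 k
    rw [r0, r1, hw0, hw1]
    rcases (SNgroup_mk_eq_iff N u w).1 hu with rfl | rfl
    · exact ⟨1, Or.inl rfl, by simp, by simp⟩
    · exact ⟨-1, Or.inr rfl, by simp, by simp⟩
  · rintro _ _ ⟨⟨s₁, t₁, ht₁, p₁, hp₁, k₁, hk₁, hk₁', rfl⟩, hγ₁⟩
      ⟨⟨s₂, t₂, ht₂, p₂, hp₂, k₂, hk₂, hk₂', rfl⟩, hγ₂⟩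
    obtain ⟨-, u₁, hu₁, -, -, h10, h11⟩ := hM s₁
    obtain ⟨-, u₂, hu₂, -, -, h20, h21⟩ := hM s₂
    obtain ⟨ε₁, hε₁, a₁, b₁⟩ :=
      (exists_Gamma1_mul_eq_or_neg_iff N A _ (hdet _ t₁ ht₁ p₁ hp₁ k₁)).1 hγ₁
    obtain ⟨ε₂, hε₂, a₂, b₂⟩ :=
      (exists_Gamma1_mul_eq_or_neg_iff N A _ (hdet _ t₂ ht₂ p₂ hp₂ k₂)).1 hγ₂
    obtain ⟨r10, r11⟩ := bottom_row_mul_Bmat N _ _ h10 h11 t₁ p₁.1 p₁.2 k₁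
    obtain ⟨r20, r21⟩ := bottom_row_mul_Bmat N _ _ h20 h21 t₂ p₂.1 p₂.2 k₂
    rw [r10, a₂, r20, ← mul_assoc, ← mul_assoc, ← Units.val_mul, ← Units.val_mul] at a₁
    rw [r11, b₂, r21, ← mul_assoc, ← mul_assoc, ← Units.val_mul, ← Units.val_mul] at b₁
    obtain ⟨rfl, rfl, rfl, hw⟩ := unit_mul_row_unique N hN Θ hmem' hinc ht₁ ht₂ hp₁ hp₂
      ⟨hk₁, hk₁'⟩ ⟨hk₂, hk₂'⟩ ((ε₂ * u₂)⁻¹ * (ε₁ * u₁))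
      (by rw [Units.val_mul, mul_assoc, ← a₁, Units.inv_mul_cancel_left])
      (by rw [Units.val_mul, mul_assoc, ← b₁, Units.inv_mul_cancel_left])
    have huu : ε₂ * u₂ = ε₁ * u₁ := inv_mul_eq_one.1 hw
    have hs : s₁ = s₂ := by
      rw [← hu₁, ← hu₂, SNgroup_mk_eq_iff]
      rcases hε₁ with rfl | rfl <;> rcases hε₂ with rfl | rfl <;> simp at huu <;> simp [huu]
    rw [hs]
end

section
/- Let N be a positive integer, 𝔞 = [a₁,a₂,a₃] ∈ 𝔈, λ ∈ 𝔖_N, and M_λ ∈ Γ₀(N) a matrix congruent to diag(λ⁻¹, λ) mod N. Then for every τ in the upper half-plane, W_𝔞(M_λ·τ) = W_{λ𝔞}(τ), where M_λ·τ denotes the Möbius action and λ𝔞 = [{λa₁},{λa₂},{λa₃}]. -/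
open scoped MatrixGroups
open Complex

/-- The pair of periods `(1, τ)`. -/
def periodPairOfIm (τ : ℂ) (hτ : 0 < τ.im) : PeriodPair where
  ω₁ := 1
  ω₂ := τ
  indep := by
    rw [LinearIndependent.pair_iff]
    intro s t h
    have him : t = 0 := by
      have := congrArg Complex.im h
      simpa [hτ.ne'] using this
    subst him
    exact ⟨by simpa using h, rfl⟩

lemma weierstrassP_periodPairOfIm (τ : ℂ) (hτ : 0 < τ.im) (z : ℂ) :
    (periodPairOfIm τ hτ).weierstrassP z =
      ∑' p : ℤ × ℤ, (1 / (z - ((p.1 : ℂ) + (p.2 : ℂ) * τ)) ^ 2 -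
        1 / ((p.1 : ℂ) + (p.2 : ℂ) * τ) ^ 2) := by
  rw [PeriodPair.weierstrassP, ← (periodPairOfIm τ hτ).latticeEquivProd.symm.toEquiv.tsum_eq]
  refine tsum_congr fun p => ?_
  have h := (periodPairOfIm τ hτ).latticeEquiv_symm_apply p
  simp only [LinearEquiv.coe_toEquiv, h]
  simp [periodPairOfIm]

lemma summable_weierstrassP_periodPairOfIm (τ : ℂ) (hτ : 0 < τ.im) (z : ℂ) :
    Summable fun p : ℤ × ℤ => (1 / (z - ((p.1 : ℂ) + (p.2 : ℂ) * τ)) ^ 2 -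
      1 / ((p.1 : ℂ) + (p.2 : ℂ) * τ) ^ 2) := by
  have hs := ((periodPairOfIm τ hτ).hasSum_weierstrassP z).summable
  rw [← (periodPairOfIm τ hτ).latticeEquivProd.symm.toEquiv.summable_iff] at hs
  refine hs.congr fun p => ?_
  have h := (periodPairOfIm τ hτ).latticeEquiv_symm_apply p
  simp only [Function.comp_apply, LinearEquiv.coe_toEquiv, h]
  simp [periodPairOfIm]

lemma wp_eq_weierstrassP (τ : ℂ) (hτ : 0 < τ.im) (z : ℂ) :
    wp τ z = (periodPairOfIm τ hτ).weierstrassP z := by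
  have hsplit := (summable_weierstrassP_periodPairOfIm τ hτ z).tsum_subtype_add_tsum_subtype_compl
    ({0} : Set (ℤ × ℤ))
  rw [weierstrassP_periodPairOfIm, ← hsplit, wp, tsum_singleton (0 : ℤ × ℤ)
    (fun p : ℤ × ℤ => (1 / (z - ((p.1 : ℂ) + (p.2 : ℂ) * τ)) ^ 2 -
      1 / ((p.1 : ℂ) + (p.2 : ℂ) * τ) ^ 2))]
  congr 1
  simp

/-- Right multiplication of integral row vectors by a matrix `!![D, C; B, A]` of determinant one. -/
def prodEquivOfDet (A B C D : ℤ) (h : A * D - B * C = 1) : ℤ × ℤ ≃ ℤ × ℤ where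
  toFun p := (p.1 * D + p.2 * B, p.1 * C + p.2 * A)
  invFun p := (p.1 * A - p.2 * B, p.2 * D - p.1 * C)
  left_inv p := by
    ext
    · linear_combination p.1 * h
    · linear_combination p.2 * h
  right_inv p := by
    ext
    · linear_combination p.1 * h
    · linear_combination p.2 * h

lemma denom_ne_zero (M : SL(2, ℤ)) (τ : ℂ) (hτ : 0 < τ.im) :
    ((M 1 0 : ℂ) * τ + (M 1 1 : ℂ)) ≠ 0 := by
  intro h
  have hdet := M.det_coe
  rw [Matrix.det_fin_two] at hdet
  have hC : M 1 0 = 0 := by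
    have := congrArg Complex.im h
    simpa [hτ.ne'] using this
  have hD : M 1 1 = 0 := by simpa [hC] using h
  simp [hC, hD] at hdet

lemma moebius_im_pos (M : SL(2, ℤ)) (τ : ℂ) (hτ : 0 < τ.im) :
    0 < (moebius (M : Matrix (Fin 2) (Fin 2) ℤ) τ).im := by
  have h := (M • (⟨τ, hτ⟩ : UpperHalfPlane)).im_pos
  rw [← UpperHalfPlane.coe_im, UpperHalfPlane.coe_specialLinearGroup_apply] at h
  simpa [moebius] using h

lemma wp_moebius (M : SL(2, ℤ)) (τ : ℂ) (hτ : 0 < τ.im) (z : ℂ) :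
    wp (moebius (M : Matrix (Fin 2) (Fin 2) ℤ) τ) z =
      ((M 1 0 : ℂ) * τ + (M 1 1 : ℂ)) ^ 2 * wp τ (((M 1 0 : ℂ) * τ + (M 1 1 : ℂ)) * z) := by
  have hj := denom_ne_zero M τ hτ
  have hdet := M.det_coe
  rw [Matrix.det_fin_two] at hdet
  rw [wp_eq_weierstrassP _ (moebius_im_pos M τ hτ), wp_eq_weierstrassP _ hτ,
    weierstrassP_periodPairOfIm, weierstrassP_periodPairOfIm, ← tsum_mul_left,
    ← (prodEquivOfDet _ _ _ _ hdet).tsum_eq (fun p : ℤ × ℤ => _ * _)]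
  refine tsum_congr fun p => ?_
  simp only [prodEquivOfDet, Equiv.coe_fn_mk]
  have hw : (p.1 : ℂ) + p.2 * moebius (M : Matrix (Fin 2) (Fin 2) ℤ) τ =
      (((p.1 * M 1 1 + p.2 * M 0 1 : ℤ) : ℂ) + ((p.1 * M 1 0 + p.2 * M 0 0 : ℤ) : ℂ) * τ) /
        ((M 1 0 : ℂ) * τ + (M 1 1 : ℂ)) := by
    rw [moebius, eq_div_iff hj, add_mul, mul_assoc (p.2 : ℂ), div_mul_cancel₀ _ hj]
    push_cast
    ring
  rw [hw]
  generalize (((p.1 * M 1 1 + p.2 * M 0 1 : ℤ) : ℂ) + _) = w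
  generalize ((M 1 0 : ℂ) * τ + (M 1 1 : ℂ)) = j at hj
  rw [show z - w / j = (j * z - w) / j by field_simp, div_pow, div_pow, one_div_div, one_div_div]
  ring

lemma wp_add_lattice (τ : ℂ) (hτ : 0 < τ.im) (z : ℂ) (m n : ℤ) :
    wp τ (z + (m + n * τ)) = wp τ z := by
  rw [wp_eq_weierstrassP _ hτ, wp_eq_weierstrassP _ hτ]
  exact (periodPairOfIm τ hτ).weierstrassP_add_coe z
    ⟨m + n * τ, PeriodPair.mem_lattice.mpr ⟨m, n, by simp [periodPairOfIm]⟩⟩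

lemma wp_neg (τ : ℂ) (hτ : 0 < τ.im) (z : ℂ) : wp τ (-z) = wp τ z := by
  rw [wp_eq_weierstrassP _ hτ, wp_eq_weierstrassP _ hτ, PeriodPair.weierstrassP_neg]

lemma exists_red_eq (N : ℕ) (a : ℤ) :
    ∃ k : ℤ, red N a = a + N * k ∨ red N a = -a + N * k := by
  have h := Int.emod_add_mul_ediv a N
  unfold red
  split_ifs
  · exact ⟨-(a / N), .inl (by linear_combination h)⟩
  · exact ⟨1 + a / N, .inr (by linear_combination -h)⟩

/-- The value of `℘` at a division point `a / N` depends only on `±a mod N`. -/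
lemma wp_red (N : ℕ) (hN : 0 < N) (τ : ℂ) (hτ : 0 < τ.im) (a : ℤ) :
    wp τ ((red N a : ℂ) / N) = wp τ ((a : ℂ) / N) := by
  have hN' : (N : ℂ) ≠ 0 := by exact_mod_cast hN.ne'
  obtain ⟨k, h | h⟩ := exists_red_eq N a
  · rw [h, ← wp_add_lattice τ hτ ((a : ℂ) / N) k 0]
    congr 1
    push_cast
    field_simp
    ring
  · rw [h, ← wp_neg τ hτ ((a : ℂ) / N), ← wp_add_lattice τ hτ (-((a : ℂ) / N)) k 0]
    congr 1
    push_cast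
    field_simp
    ring

lemma wp_moebius_div (N : ℕ) (hN : 0 < N) (M : SL(2, ℤ)) (l : ℤ)
    (hC : ((M 1 0 : ℤ) : ZMod N) = 0)
    (hD : ((M 1 1 : ℤ) : ZMod N) = (l : ZMod N) ∨ ((M 1 1 : ℤ) : ZMod N) = (-l : ZMod N))
    (τ : ℂ) (hτ : 0 < τ.im) (a : ℤ) :
    wp (moebius (M : Matrix (Fin 2) (Fin 2) ℤ) τ) ((a : ℂ) / N) =
      ((M 1 0 : ℂ) * τ + (M 1 1 : ℂ)) ^ 2 * wp τ ((red N (l * a) : ℂ) / N) := by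
  have hN' : (N : ℂ) ≠ 0 := by exact_mod_cast hN.ne'
  rw [wp_moebius M τ hτ, wp_red N hN τ hτ]
  congr 1
  obtain ⟨c, hc⟩ := (ZMod.intCast_zmod_eq_zero_iff_dvd _ N).mp hC
  rcases hD with hD | hD
  · have hD' : ((M 1 1 - l : ℤ) : ZMod N) = 0 := by push_cast; rw [hD, sub_self]
    obtain ⟨d, hd⟩ := (ZMod.intCast_zmod_eq_zero_iff_dvd _ N).mp hD'
    rw [← wp_add_lattice τ hτ (((l * a : ℤ) : ℂ) / N) (d * a) (c * a), hc, eq_add_of_sub_eq hd]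
    congr 1
    push_cast
    field_simp
    ring
  · have hD' : ((M 1 1 + l : ℤ) : ZMod N) = 0 := by push_cast; rw [hD, neg_add_cancel]
    obtain ⟨d, hd⟩ := (ZMod.intCast_zmod_eq_zero_iff_dvd _ N).mp hD'
    rw [← wp_neg τ hτ (((l * a : ℤ) : ℂ) / N),
      ← wp_add_lattice τ hτ (-(((l * a : ℤ) : ℂ) / N)) (d * a) (c * a), hc,
      eq_sub_of_add_eq hd]
    congr 1
    push_cast
    field_simp
    ring

/-- `W_𝔞(M_λ·τ) = W_{λ𝔞}(τ)`, where `λ ∈ 𝔖_N` is represented by an integer `ℓ`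
invertible mod `N`, `M_λ ∈ Γ₀(N)` is congruent to `diag(λ⁻¹, λ) mod N`, and
`λ𝔞 = [{ℓa₁},{ℓa₂},{ℓa₃}]`. -/
theorem stmt6 (N : ℕ) (hN : 0 < N) (a : ℤ × ℤ × ℤ) (ha : memE N a)
    (l ls : ℤ) (hl : l * ls ≡ 1 [ZMOD (N : ℤ)])
    (M : SL(2, ℤ)) (hM0 : M ∈ CongruenceSubgroup.Gamma0 N)
    (hM : (((M 0 0 : ℤ) : ZMod N) = (ls : ZMod N) ∧ ((M 0 1 : ℤ) : ZMod N) = 0 ∧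
           ((M 1 0 : ℤ) : ZMod N) = 0 ∧ ((M 1 1 : ℤ) : ZMod N) = (l : ZMod N)) ∨
          (((M 0 0 : ℤ) : ZMod N) = (-ls : ZMod N) ∧ ((M 0 1 : ℤ) : ZMod N) = 0 ∧
           ((M 1 0 : ℤ) : ZMod N) = 0 ∧ ((M 1 1 : ℤ) : ZMod N) = (-l : ZMod N)))
    (τ : ℂ) (hτ : 0 < τ.im) :
    Wfun N a.1 a.2.1 a.2.2 (moebius ((M : SL(2, ℤ)) : Matrix (Fin 2) (Fin 2) ℤ) τ)
      = Wfun N (red N (l * a.1)) (red N (l * a.2.1)) (red N (l * a.2.2)) τ := by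
  have hC : ((M 1 0 : ℤ) : ZMod N) = 0 := hM.elim (·.2.2.1) (·.2.2.1)
  have hD : ((M 1 1 : ℤ) : ZMod N) = (l : ZMod N) ∨ ((M 1 1 : ℤ) : ZMod N) = (-l : ZMod N) :=
    hM.imp (·.2.2.2) (·.2.2.2)
  simp only [Wfun, wp_moebius_div N hN M l hC hD τ hτ, ← mul_sub]
  exact mul_div_mul_left _ _ (pow_ne_zero 2 (denom_ne_zero M τ hτ))
end
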